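/- Let p ≥ 2 be an integer and α ∈ (1,2). There exists a constant C_{p,α}^R > 0 depending only on p and α such that for all n ≥ 1 and each q ∈ {1, 2, ∞}, the induced matrix norm satisfies ‖n^{-α} A_n^R‖_q ≤ C_{p,α}^R, where ‖·‖_1 is the maximum absolute column sum, ‖·‖_∞ is the maximum absolute row sum, and ‖·‖_2 is the spectral norm. -/

import Mathlib

open MeasureTheory

/-- Open uniform knot sequence on [0,1]. -/
noncomputable def knot (p n : ℕ) (i : ℕ) : ℝ :=
  if i ≤ p + 1 then 0 else if n + p + 1 ≤ i then 1 else ((i : ℝ) - ((p : ℝ) + 1)) / n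

/-- B-splines of degree `k` (Cox–de Boor recurrence) on the above knots. -/
noncomputable def bspline (p n : ℕ) : ℕ → ℕ → ℝ → ℝ
  | 0, i, x => if knot p n i ≤ x ∧ x < knot p n (i + 1) then 1 else 0
  | (k + 1), i, x =>
      (if knot p n (i + k + 1) = knot p n i then 0
        else (x - knot p n i) / (knot p n (i + k + 1) - knot p n i) * bspline p n k i x)
      + (if knot p n (i + k + 2) = knot p n (i + 1) then 0
        else (knot p n (i + k + 2) - x) / (knot p n (i + k + 2) - knot p n (i + 1))
              * bspline p n k (i + 1) x)

/-- Greville abscissae. -/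
noncomputable def greville (p n : ℕ) (i : ℕ) : ℝ :=
  (∑ j ∈ Finset.range p, knot p n (i + 1 + j)) / p

/-- Right Riemann–Liouville fractional derivative on `[0,1]`, `α ∈ (1,2)`. -/
noncomputable def RLDx1 (α : ℝ) (u : ℝ → ℝ) (x : ℝ) : ℝ :=
  (1 / Real.Gamma (2 - α)) *
    deriv (deriv (fun z => ∫ y in z..(1:ℝ), (y - z) ^ (1 - α) * u y)) x

/-- Collocation matrix `A_n^R`. -/
noncomputable def ARmat (p n : ℕ) (α : ℝ) : Matrix (Fin (n + p - 2)) (Fin (n + p - 2)) ℝ :=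
  Matrix.of fun i j => RLDx1 α (bspline p n p ((j : ℕ) + 2)) (greville p n ((i : ℕ) + 2))

/-- Maximum absolute column sum norm. -/
noncomputable def matNorm1 {N : ℕ} (A : Matrix (Fin N) (Fin N) ℝ) : ℝ :=
  ⨆ j, ∑ i, |A i j|

/-- Maximum absolute row sum norm. -/
noncomputable def matNormInf {N : ℕ} (A : Matrix (Fin N) (Fin N) ℝ) : ℝ :=
  ⨆ i, ∑ j, |A i j|

/-- Spectral norm (operator 2-norm). -/
noncomputable def matNorm2 {N : ℕ} (A : Matrix (Fin N) (Fin N) ℝ) : ℝ :=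
  ‖LinearMap.toContinuousLinearMap (Matrix.toEuclideanLin A)‖


lemma knot_mono (p n : ℕ) (hn : 1 ≤ n) : Monotone (knot p n) := by
  have hn' : (0:ℝ) < n := by exact_mod_cast hn
  apply monotone_nat_of_le_succ
  intro i
  unfold knot
  split_ifs with h1 h2 h3 h4 h5 h6 <;> first | omega | norm_num | skip
  · push_cast
    apply div_nonneg _ hn'.le
    have : (p:ℝ) + 1 < i + 1 := by exact_mod_cast (by omega : p + 1 < i + 1)
    linarith
  · rw [div_le_one hn']
    have : (i:ℝ) < n + p + 1 := by exact_mod_cast (by omega : i < n + p + 1)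
    linarith
  · push_cast
    gcongr
    linarith

lemma knot_nonneg (p n : ℕ) (hn : 1 ≤ n) (i : ℕ) : 0 ≤ knot p n i := by
  have := knot_mono p n hn (Nat.zero_le i)
  simpa [knot] using this

lemma knot_eq (p n : ℕ) (hn : 1 ≤ n) (l : ℕ) (hl : l ≤ n) : knot p n (p + 1 + l) = l / n := by
  have hn' : (0:ℝ) < n := by exact_mod_cast hn
  unfold knot
  split_ifs with h1 h2
  · have : l = 0 := by omega
    simp [this]
  · have : l = n := by omega
    subst this; field_simp
  · push_cast; ring

lemma knot_le_one (p n : ℕ) (hn : 1 ≤ n) (i : ℕ) : knot p n i ≤ 1 := by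
  have h1 := knot_mono p n hn (show i ≤ i + n + p + 1 by omega)
  have : knot p n (i + n + p + 1) = 1 := by
    unfold knot
    rw [if_neg (by omega), if_pos (by omega)]
  linarith

/-- every knot is a multiple of 1/n, described by natural truncation -/
lemma knot_form (p n : ℕ) (hn : 1 ≤ n) (i : ℕ) :
    knot p n i = ((min n (i - (p + 1)) : ℕ) : ℝ) / n := by
  have hn' : (0:ℝ) < n := by exact_mod_cast hn
  unfold knot
  split_ifs with h1 h2
  · have : i - (p+1) = 0 := by omega
    simp [this]
  · rw [min_eq_left (by omega)]; field_simp
  · rw [min_eq_right (by omega), Nat.cast_sub (by omega)]; push_cast; ring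

lemma knot_gap (p n : ℕ) (hn : 1 ≤ n) (i j : ℕ) (h : knot p n i < knot p n j) :
    1 / (n:ℝ) ≤ knot p n j - knot p n i := by
  have hn' : (0:ℝ) < n := by exact_mod_cast hn
  rw [knot_form p n hn, knot_form p n hn] at h ⊢
  rw [div_lt_div_iff_of_pos_right hn'] at h
  have h' : min n (i - (p + 1)) + 1 ≤ min n (j - (p + 1)) := by exact_mod_cast h
  have h'' : ((min n (i - (p + 1)) : ℕ):ℝ) + 1 ≤ (min n (j - (p + 1)) : ℕ) := by exact_mod_cast h'
  rw [← sub_div]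
  gcongr
  linarith

lemma knot_width (p n : ℕ) (hn : 1 ≤ n) (i m : ℕ) :
    knot p n (i + m) ≤ knot p n i + m / n := by
  have hn' : (0:ℝ) < n := by exact_mod_cast hn
  rw [knot_form p n hn, knot_form p n hn, ← add_div]
  gcongr
  exact_mod_cast (by omega : min n (i + m - (p + 1)) ≤ min n (i - (p + 1)) + m)

/-- inverse gap -/
noncomputable def dinv (p n i m : ℕ) : ℝ := (knot p n (i + m) - knot p n i)⁻¹

lemma dinv_nonneg (p n : ℕ) (hn : 1 ≤ n) (i m : ℕ) : 0 ≤ dinv p n i m := by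
  unfold dinv
  have := knot_mono p n hn (show i ≤ i + m by omega)
  exact inv_nonneg.2 (by linarith)

lemma dinv_le (p n : ℕ) (hn : 1 ≤ n) (i m : ℕ) : dinv p n i m ≤ n := by
  have hn' : (0:ℝ) < n := by exact_mod_cast hn
  unfold dinv
  have h := knot_mono p n hn (show i ≤ i + m by omega)
  rcases h.eq_or_lt with h | h
  · simp [h, hn'.le]
  · have := knot_gap p n hn _ _ h
    rw [inv_le_comm₀ (by linarith) hn']
    simpa using this

lemma bs_zero (p n i : ℕ) (x : ℝ) :
    bspline p n 0 i x = if knot p n i ≤ x ∧ x < knot p n (i + 1) then 1 else 0 := by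
  rw [bspline]

lemma bs_succ (p n k i : ℕ) (x : ℝ) :
    bspline p n (k+1) i x = (x - knot p n i) * dinv p n i (k+1) * bspline p n k i x
      + (knot p n (i + k + 2) - x) * dinv p n (i+1) (k+1) * bspline p n k (i+1) x := by
  rw [bspline]
  unfold dinv
  have e : i + 1 + (k + 1) = i + k + 2 := by ring
  have e' : i + (k + 1) = i + k + 1 := by ring
  rw [e, e']
  congr 1
  · split_ifs with h
    · simp [h]
    · rw [div_eq_mul_inv]
  · split_ifs with h
    · simp [h]
    · rw [div_eq_mul_inv]

lemma bs_supp (p n : ℕ) (hn : 1 ≤ n) (k : ℕ) : ∀ (i : ℕ) (x : ℝ),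
    (x < knot p n i ∨ knot p n (i + k + 1) ≤ x) → bspline p n k i x = 0 := by
  induction k with
  | zero =>
    intro i x h
    rw [bs_zero, if_neg]
    rintro ⟨h1, h2⟩
    rcases h with h | h
    · linarith
    · simp at h; linarith
  | succ k ih =>
    intro i x h
    rw [bs_succ, ih i, ih (i+1)]
    · simp
    · rcases h with h | h
      · left; exact h.trans_le (knot_mono p n hn (by omega))
      · right
        exact le_of_eq_of_le (by congr 1; ring) h
    · rcases h with h | h
      · left; exact h
      · right; exact (knot_mono p n hn (by omega)).trans h

lemma bs_bound (p n : ℕ) (hn : 1 ≤ n) (k : ℕ) : ∀ (i : ℕ) (x : ℝ),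
    |bspline p n k i x| ≤ 2 ^ k := by
  induction k with
  | zero =>
    intro i x
    rw [bs_zero]; split_ifs <;> simp
  | succ k ih =>
    intro i x
    by_cases hx : x < knot p n i ∨ knot p n (i + (k+1) + 1) ≤ x
    · rw [bs_supp p n hn _ _ _ hx]; simp
    push Not at hx
    have A : |(x - knot p n i) * dinv p n i (k+1) * bspline p n k i x| ≤ 2 ^ k := by
      by_cases hy : x < knot p n i ∨ knot p n (i + k + 1) ≤ x
      · rw [bs_supp p n hn _ _ _ hy]; simp
      push Not at hy
      rw [abs_mul]
      have : |(x - knot p n i) * dinv p n i (k+1)| ≤ 1 := by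
        unfold dinv
        rw [← div_eq_mul_inv, abs_of_nonneg (div_nonneg (by linarith) (by rw [← add_assoc]; linarith))]
        apply div_le_one_of_le₀ <;> rw [← add_assoc] <;> linarith
      calc _ ≤ 1 * (2:ℝ) ^ k := mul_le_mul this (ih i x) (abs_nonneg _) zero_le_one
        _ = _ := one_mul _
    have B : |(knot p n (i + k + 2) - x) * dinv p n (i+1) (k+1) * bspline p n k (i+1) x| ≤ 2 ^ k := by
      have e : i + 1 + (k + 1) = i + k + 2 := by ring
      have e2 : i + 1 + k + 1 = i + k + 2 := by ring
      by_cases hy : x < knot p n (i+1) ∨ knot p n (i + 1 + k + 1) ≤ x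
      · rw [bs_supp p n hn _ _ _ hy]; simp
      push Not at hy
      rw [e2] at hy
      rw [abs_mul]
      have : |(knot p n (i + k + 2) - x) * dinv p n (i+1) (k+1)| ≤ 1 := by
        unfold dinv
        rw [e, ← div_eq_mul_inv, abs_of_nonneg (div_nonneg (by linarith) (by linarith))]
        apply div_le_one_of_le₀ <;> linarith
      calc _ ≤ 1 * (2:ℝ) ^ k := mul_le_mul this (ih _ x) (abs_nonneg _) zero_le_one
        _ = _ := one_mul _
    rw [bs_succ]
    calc _ ≤ _ := abs_add_le _ _
      _ ≤ 2 ^ k + 2 ^ k := add_le_add A B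
      _ = _ := by ring

lemma bs_meas (p n : ℕ) (k : ℕ) : ∀ (i : ℕ), Measurable (bspline p n k i) := by
  induction k with
  | zero =>
    intro i
    have : bspline p n 0 i = fun x => if knot p n i ≤ x ∧ x < knot p n (i + 1) then (1:ℝ) else 0 := by
      ext x; rw [bs_zero]
    rw [this]
    exact Measurable.ite measurableSet_Ico measurable_const measurable_const
  | succ k ih =>
    intro i
    have := funext (bs_succ p n k i)
    rw [this]
    have h1 := ih i
    have h2 := ih (i+1)
    fun_prop

/-- derivative of B-splines -/
noncomputable def dspl (p n : ℕ) : ℕ → ℕ → ℝ → ℝ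
  | 0, _, _ => 0
  | (k+1), i, x => (k+1) * (dinv p n i (k+1) * bspline p n k i x
      - dinv p n (i+1) (k+1) * bspline p n k (i+1) x)

lemma bs_deriv (p n : ℕ) (hn : 1 ≤ n) (k : ℕ) : ∀ (i : ℕ) (x : ℝ), x ∉ Set.range (knot p n) →
    HasDerivAt (bspline p n k i) (dspl p n k i x) x := by
  induction k with
  | zero =>
    intro i x hx
    rw [dspl]
    have h1 : knot p n i ≠ x := fun h => hx ⟨_, h⟩
    have h2 : knot p n (i+1) ≠ x := fun h => hx ⟨_, h⟩
    have : bspline p n 0 i =ᶠ[nhds x] fun _ => bspline p n 0 i x := by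
      have a1 : ∀ᶠ y in nhds x, (knot p n i ≤ y ↔ knot p n i ≤ x) := by
        rcases lt_or_gt_of_ne h1 with h | h
        · filter_upwards [lt_mem_nhds h] with y hy
          simp [hy.le, h.le]
        · filter_upwards [gt_mem_nhds h] with y hy
          simp [not_le.2 hy, not_le.2 h]
      have a2 : ∀ᶠ y in nhds x, (y < knot p n (i+1) ↔ x < knot p n (i+1)) := by
        rcases lt_or_gt_of_ne h2 with h | h
        · filter_upwards [lt_mem_nhds h] with y hy
          simp [not_lt.2 hy.le, not_lt.2 h.le]
        · filter_upwards [gt_mem_nhds h] with y hy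
          simp [hy, h]
      filter_upwards [a1, a2] with y h1 h2
      rw [bs_zero, bs_zero]; simp only [h1, h2]
    exact (hasDerivAt_const x _).congr_of_eventuallyEq this
  | succ k ih =>
    intro i x hx
    rw [funext (bs_succ p n k i)]
    have d1 := (((hasDerivAt_id x).sub_const (knot p n i)).mul_const (dinv p n i (k+1))).mul (ih i x hx)
    have d2 := (((hasDerivAt_id x).const_sub (knot p n (i+k+2))).mul_const (dinv p n (i+1) (k+1))).mul
      (ih (i+1) x hx)
    refine (d1.add d2).congr_deriv ?_
    simp only [id]
    cases k with
    | zero => simp [dspl]; ring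
    | succ k =>
      have key : (dinv p n (i+1) (k+1)) * (dinv p n i (k+2) * (knot p n (i+k+2) - knot p n i)
         - dinv p n (i+1) (k+2) * (knot p n (i+k+3) - knot p n (i+1))) = 0 := by
        have e1 : i + 1 + (k + 1) = i + k + 2 := by ring
        have e2 : i + 1 + (k + 2) = i + k + 3 := by ring
        have e3 : i + (k + 2) = i + k + 2 := by ring
        have m := knot_mono p n hn
        rcases (m (show i + 1 ≤ i + k + 2 by omega)).eq_or_lt with h | h
        · simp [dinv, e1, h]
        · have m1 := m (show i ≤ i + 1 by omega)
          have m2 := m (show i + k + 2 ≤ i + k + 3 by omega)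
          unfold dinv
          rw [e1, e2, e3, inv_mul_cancel₀ (by linarith), inv_mul_cancel₀ (by linarith)]
          simp
      simp only [dspl]
      rw [bs_succ p n k i, bs_succ p n k (i+1)]
      have e4 : i + 1 + k + 2 = i + k + 3 := by ring
      have e5 : i + (k + 1) + 2 = i + k + 3 := by ring
      have e6 : k + 1 + 1 = k + 2 := by ring
      rw [e4, e5, e6]
      push_cast
      linear_combination (-(k+1) * bspline p n k (i+1) x) * key

lemma knot_eq_succ (p n : ℕ) (hn : 1 ≤ n) (i : ℕ) (h : knot p n i = knot p n (i+1)) :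
    knot p n i = 0 ∨ knot p n i = 1 := by
  have hn' : (0:ℝ) < n := by exact_mod_cast hn
  rw [knot_form p n hn, knot_form p n hn, div_left_inj' hn'.ne'] at h
  have h' : min n (i - (p + 1)) = min n (i + 1 - (p + 1)) := by exact_mod_cast h
  rw [knot_form p n hn]
  have : min n (i - (p + 1)) = 0 ∨ min n (i - (p + 1)) = n := by omega
  rcases this with h | h
  · left; simp [h]
  · right; rw [h]; field_simp

lemma bs_one_cont (p n : ℕ) (hn : 1 ≤ n) (i : ℕ) :
    ContinuousOn (bspline p n 1 i) (Set.Ioo 0 1) := by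
  set a := knot p n i with ha
  set b := knot p n (i+1) with hb
  set c := knot p n (i+2) with hc
  have hab : a ≤ b := knot_mono p n hn (by omega)
  have hbc : b ≤ c := knot_mono p n hn (by omega)
  have ha0 : 0 ≤ a := knot_nonneg p n hn _
  have hc1 : c ≤ 1 := knot_le_one p n hn _
  have form : ∀ x, bspline p n 1 i x = (x - a) * (b - a)⁻¹ * (if a ≤ x ∧ x < b then 1 else 0)
      + (c - x) * (c - b)⁻¹ * (if b ≤ x ∧ x < c then 1 else 0) := by
    intro x
    rw [bs_succ, bs_zero, bs_zero]; rfl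
  rcases hab.eq_or_lt with h1 | h1
  · rcases hbc.eq_or_lt with h2 | h2
    · apply (continuousOn_const (c := (0:ℝ))).congr
      intro x hx
      rw [form]; simp [h1, h2]
    · have : a = 0 := by
        rcases knot_eq_succ p n hn i h1 with h | h
        · exact h
        · linarith
      have hcc : ContinuousOn (fun x => max 0 ((c - x) * (c - b)⁻¹)) (Set.Ioo 0 1) := by fun_prop
      apply hcc.congr
      intro x hx
      simp only
      have pos : 0 < (c - b)⁻¹ := inv_pos.2 (by linarith)
      have hx0 := hx.1
      rw [form, if_neg (by rintro ⟨h3, h4⟩; linarith)]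
      split_ifs with h5
      · rw [max_eq_right (mul_nonneg (by linarith) pos.le)]; ring
      · have : c ≤ x := by
          by_contra h6
          exact h5 ⟨by linarith, by linarith⟩
        rw [max_eq_left (mul_nonpos_of_nonpos_of_nonneg (by linarith) pos.le)]; ring
  · have pos1 : 0 < (b - a)⁻¹ := inv_pos.2 (by linarith)
    have one1 : (b - a) * (b-a)⁻¹ = 1 := mul_inv_cancel₀ (by linarith)
    rcases hbc.eq_or_lt with h2 | h2
    · have : b = 1 := by
        rcases knot_eq_succ p n hn (i+1) h2 with h | h
        · linarith
        · exact h
      have hcc : ContinuousOn (fun x => max 0 ((x - a) * (b - a)⁻¹)) (Set.Ioo 0 1) := by fun_prop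
      apply hcc.congr
      intro x hx
      simp only
      have hx0 := hx.2
      rw [form, if_neg (c := b ≤ x ∧ x < c) (by rintro ⟨h3, h4⟩; linarith)]
      split_ifs with h5
      · rw [max_eq_right (mul_nonneg (by linarith) pos1.le)]; ring
      · have : x < a := by
          by_contra h6
          exact h5 ⟨by linarith, by linarith⟩
        rw [max_eq_left (mul_nonpos_of_nonpos_of_nonneg (by linarith) pos1.le)]; ring
    · have pos2 : 0 < (c - b)⁻¹ := inv_pos.2 (by linarith)
      have one2 : (c - b) * (c-b)⁻¹ = 1 := mul_inv_cancel₀ (by linarith)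
      have hcc : ContinuousOn (fun x => max 0 (min ((x - a) * (b - a)⁻¹) ((c - x) * (c - b)⁻¹)))
        (Set.Ioo 0 1) := by fun_prop
      apply hcc.congr
      intro x hx
      simp only
      rw [form]
      rcases lt_or_ge x a with h3 | h3
      · rw [if_neg (by rintro ⟨_, _⟩; linarith), if_neg (by rintro ⟨_, _⟩; linarith), max_eq_left]
        · ring
        · exact (min_le_left _ _).trans (mul_nonpos_of_nonpos_of_nonneg (by linarith) pos1.le)
      rcases lt_or_ge x b with h4 | h4
      · rw [if_pos ⟨h3, h4⟩, if_neg (by rintro ⟨_, _⟩; linarith), min_eq_left, max_eq_right]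
        · ring
        · exact mul_nonneg (by linarith) pos1.le
        · nlinarith
      rcases lt_or_ge x c with h5 | h5
      · rw [if_neg (by rintro ⟨_, _⟩; linarith), if_pos ⟨h4, h5⟩, min_eq_right, max_eq_right]
        · ring
        · exact mul_nonneg (by linarith) pos2.le
        · nlinarith
      · rw [if_neg (by rintro ⟨_, _⟩; linarith), if_neg (by rintro ⟨_, _⟩; linarith), max_eq_left]
        · ring
        · exact (min_le_right _ _).trans (mul_nonpos_of_nonpos_of_nonneg (by linarith) pos2.le)

lemma bs_cont (p n : ℕ) (hn : 1 ≤ n) (k : ℕ) : ∀ i : ℕ,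
    ContinuousOn (bspline p n (k+1) i) (Set.Ioo 0 1) := by
  induction k with
  | zero => exact bs_one_cont p n hn
  | succ k ih =>
    intro i
    rw [funext (bs_succ p n (k+1) i)]
    have h1 := ih i
    have h2 := ih (i+1)
    fun_prop

lemma bs_tendsto (p n : ℕ) (hn : 1 ≤ n) (k : ℕ) : ∀ i : ℕ, i + 1 ≤ n + p →
    Filter.Tendsto (bspline p n k i) (nhdsWithin 1 (Set.Iio 1)) (nhds 0) := by
  have hn' : (0:ℝ) < n := by exact_mod_cast hn
  induction k with
  | zero =>
    intro i hi
    have hlt : knot p n (i+1) < 1 := by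
      rw [knot_form p n hn, div_lt_one hn']
      exact_mod_cast (by omega : min n (i + 1 - (p + 1)) < n)
    apply tendsto_const_nhds.congr'
    have : ∀ᶠ x in nhdsWithin (1:ℝ) (Set.Iio 1), knot p n (i+1) < x :=
      nhdsWithin_le_nhds (lt_mem_nhds hlt)
    filter_upwards [this] with x hx
    rw [bs_supp p n hn 0 i x (Or.inr hx.le)]
  | succ k ih =>
    intro i hi
    rw [funext (bs_succ p n k i)]
    have t1 : Filter.Tendsto (fun x => (x - knot p n i) * dinv p n i (k+1)) (nhdsWithin 1 (Set.Iio 1))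
        (nhds ((1 - knot p n i) * dinv p n i (k+1))) := by
      apply Filter.Tendsto.mono_left _ nhdsWithin_le_nhds
      apply Continuous.tendsto (f := fun x => (x - knot p n i) * dinv p n i (k+1))
      fun_prop
    have t2 : Filter.Tendsto (fun x => (knot p n (i+k+2) - x) * dinv p n (i+1) (k+1))
        (nhdsWithin 1 (Set.Iio 1)) (nhds ((knot p n (i+k+2) - 1) * dinv p n (i+1) (k+1))) := by
      apply Filter.Tendsto.mono_left _ nhdsWithin_le_nhds
      apply Continuous.tendsto (f := fun x => (knot p n (i+k+2) - x) * dinv p n (i+1) (k+1))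
      fun_prop
    have s1 := t1.mul (ih i hi)
    rw [mul_zero] at s1
    have s2 : Filter.Tendsto (fun x => (knot p n (i+k+2) - x) * dinv p n (i+1) (k+1)
        * bspline p n k (i+1) x) (nhdsWithin 1 (Set.Iio 1)) (nhds 0) := by
      by_cases h : i + 1 + 1 ≤ n + p
      · have := t2.mul (ih (i+1) h)
        rwa [mul_zero] at this
      · have e : knot p n (i+k+2) = 1 := by
          unfold knot
          rw [if_neg (by omega), if_pos (by omega)]
        rw [e] at t2 ⊢
        rw [sub_self, zero_mul] at t2
        apply t2.zero_mul_isBoundedUnder_le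
        apply Filter.isBoundedUnder_of
        exact ⟨2 ^ k, fun x => bs_bound p n hn k (i+1) x⟩
    simpa using s1.add s2

lemma dspl_bound (p n : ℕ) (hn : 1 ≤ n) (k i : ℕ) (x : ℝ) :
    |dspl p n k i x| ≤ k * n * 2 ^ k := by
  have hn' : (0:ℝ) < n := by exact_mod_cast hn
  cases k with
  | zero => simp [dspl]
  | succ k =>
    rw [dspl, abs_mul]
    have A : ∀ j, |dinv p n j (k+1) * bspline p n k j x| ≤ n * 2 ^ k := by
      intro j
      rw [abs_mul, abs_of_nonneg (dinv_nonneg p n hn _ _)]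
      exact mul_le_mul (dinv_le p n hn _ _) (bs_bound p n hn _ _ _) (abs_nonneg _) hn'.le
    have := (abs_sub (dinv p n i (k+1) * bspline p n k i x)
      (dinv p n (i+1) (k+1) * bspline p n k (i+1) x)).trans (add_le_add (A i) (A (i+1)))
    rw [abs_of_nonneg (by positivity)]
    push_cast
    calc _ ≤ ((k:ℝ)+1) * (n * 2 ^ k + n * 2 ^ k) := by gcongr
      _ = _ := by ring

lemma dspl_meas (p n k i : ℕ) : Measurable (dspl p n k i) := by
  cases k with
  | zero => exact measurable_const
  | succ k =>
    have h1 := bs_meas p n k i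
    have h2 := bs_meas p n k (i+1)
    unfold dspl
    fun_prop

lemma dspl_supp (p n : ℕ) (hn : 1 ≤ n) (k i : ℕ) (x : ℝ)
    (h : x < knot p n i ∨ knot p n (i + k + 1) ≤ x) : dspl p n k i x = 0 := by
  cases k with
  | zero => rfl
  | succ k =>
    rw [dspl, bs_supp p n hn k i, bs_supp p n hn k (i+1)]
    · simp
    · rcases h with h | h
      · left; exact h.trans_le (knot_mono p n hn (by omega))
      · right
        exact le_of_eq_of_le (by congr 1; ring) h
    · rcases h with h | h
      · left; exact h
      · right; exact (knot_mono p n hn (by omega)).trans h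

lemma dspl_cont_off (p n : ℕ) (hn : 1 ≤ n) (k i : ℕ) (x : ℝ) (hx : x ∉ Set.range (knot p n)) :
    ContinuousAt (dspl p n k i) x := by
  cases k with
  | zero => exact continuousAt_const
  | succ k =>
    have h1 := (bs_deriv p n hn k i x hx).continuousAt
    have h2 := (bs_deriv p n hn k (i+1) x hx).continuousAt
    unfold dspl
    fun_prop

/-- second derivative of B-splines -/
noncomputable def ddspl (p n k i : ℕ) (x : ℝ) : ℝ :=
  (k+2) * (dinv p n i (k+2) * dspl p n (k+1) i x - dinv p n (i+1) (k+2) * dspl p n (k+1) (i+1) x)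

lemma dspl_deriv (p n : ℕ) (hn : 1 ≤ n) (k i : ℕ) (x : ℝ) (hx : x ∉ Set.range (knot p n)) :
    HasDerivAt (dspl p n (k+2) i) (ddspl p n k i x) x := by
  have h1 := (bs_deriv p n hn (k+1) i x hx).const_mul (dinv p n i (k+2))
  have h2 := (bs_deriv p n hn (k+1) (i+1) x hx).const_mul (dinv p n (i+1) (k+2))
  have := (h1.sub h2).const_mul ((k:ℝ)+2)
  have e : dspl p n (k+2) i = fun x => ((k:ℝ)+2) * (dinv p n i (k+2) * bspline p n (k+1) i x -
      dinv p n (i+1) (k+2) * bspline p n (k+1) (i+1) x) := by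
    ext x
    rw [dspl]; push_cast; ring
  rw [e]
  exact this

lemma dspl_cont (p n : ℕ) (hn : 1 ≤ n) (k i : ℕ) :
    ContinuousOn (dspl p n (k+2) i) (Set.Ioo 0 1) := by
  have h1 := bs_cont p n hn k i
  have h2 := bs_cont p n hn k (i+1)
  unfold dspl
  fun_prop

lemma ddspl_bound (p n : ℕ) (hn : 1 ≤ n) (k i : ℕ) (x : ℝ) :
    |ddspl p n k i x| ≤ (k+2) * (k+1) * 2 ^ (k+2) * (n:ℝ)^2 := by
  have hn' : (0:ℝ) < n := by exact_mod_cast hn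
  rw [ddspl, abs_mul]
  have A : ∀ j, |dinv p n j (k+2) * dspl p n (k+1) j x| ≤ n * (((k+1:ℕ):ℝ) * n * 2 ^ (k+1)) := by
    intro j
    rw [abs_mul, abs_of_nonneg (dinv_nonneg p n hn _ _)]
    exact mul_le_mul (dinv_le p n hn _ _) (dspl_bound p n hn _ _ _) (abs_nonneg _) hn'.le
  have := (abs_sub (dinv p n i (k+2) * dspl p n (k+1) i x)
      (dinv p n (i+1) (k+2) * dspl p n (k+1) (i+1) x)).trans (add_le_add (A i) (A (i+1)))
  rw [abs_of_nonneg (by positivity)]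
  calc _ ≤ ((k:ℝ)+2) * _ := mul_le_mul_of_nonneg_left this (by positivity)
    _ = _ := by push_cast; ring

lemma ddspl_meas (p n k i : ℕ) : Measurable (ddspl p n k i) := by
  have h1 := dspl_meas p n (k+1) i
  have h2 := dspl_meas p n (k+1) (i+1)
  unfold ddspl
  fun_prop

lemma ddspl_supp (p n : ℕ) (hn : 1 ≤ n) (k i : ℕ) (x : ℝ)
    (h : x < knot p n i ∨ knot p n (i + k + 3) ≤ x) : ddspl p n k i x = 0 := by
  rw [ddspl, dspl_supp p n hn (k+1) i, dspl_supp p n hn (k+1) (i+1)]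
  · simp
  · rcases h with h | h
    · left; exact h.trans_le (knot_mono p n hn (by omega))
    · right
      exact le_of_eq_of_le (by congr 1; ring) h
  · rcases h with h | h
    · left; exact h
    · right; exact (knot_mono p n hn (by omega)).trans h

lemma ddspl_cont_off (p n : ℕ) (hn : 1 ≤ n) (k i : ℕ) (x : ℝ) (hx : x ∉ Set.range (knot p n)) :
    ContinuousAt (ddspl p n k i) x := by
  have h1 := dspl_cont_off p n hn (k+1) i x hx
  have h2 := dspl_cont_off p n hn (k+1) (i+1) x hx
  unfold ddspl
  fun_prop

lemma bdd_intervalIntegrable (v : ℝ → ℝ) (hm : Measurable v) (M : ℝ) (hM : ∀ y, |v y| ≤ M) (a b : ℝ) :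
    IntervalIntegrable v volume a b := by
  rw [intervalIntegrable_iff]
  apply Measure.integrableOn_of_bounded (M := M)
  · exact measure_Ioc_lt_top.ne
  · exact hm.aestronglyMeasurable
  · exact Filter.Eventually.of_forall (fun y => hM y)

lemma rpow_intOn (β : ℝ) (hβ : -1 < β) : IntegrableOn (fun t : ℝ => t ^ β) (Set.Ioo 0 1) volume := by
  have := (intervalIntegral.intervalIntegrable_rpow' (a := 0) (b := 1) hβ)
  rw [intervalIntegrable_iff_integrableOn_Ioo_of_le zero_le_one] at this
  exact this

lemma rpow_mul_intOn (β : ℝ) (hβ : -1 < β) (f : ℝ → ℝ) (hm : Measurable f) (C : ℝ)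
    (hC : ∀ t ∈ Set.Ioo (0:ℝ) 1, |f t| ≤ C) :
    IntegrableOn (fun t : ℝ => t ^ β * f t) (Set.Ioo 0 1) volume := by
  apply Integrable.mul_bdd (c := C) (rpow_intOn β hβ) hm.aestronglyMeasurable
  exact (ae_restrict_iff' measurableSet_Ioo).2 (Filter.Eventually.of_forall hC)

lemma prim_lip (v : ℝ → ℝ) (hm : Measurable v) (M : ℝ) (hM : ∀ y, |v y| ≤ M) (x y : ℝ) :
    |(∫ s in (0:ℝ)..x, v s) - ∫ s in (0:ℝ)..y, v s| ≤ M * |x - y| := by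
  have I := bdd_intervalIntegrable v hm M hM
  rw [intervalIntegral.integral_interval_sub_left (I _ _) (I _ _)]
  rw [← Real.norm_eq_abs]
  apply intervalIntegral.norm_integral_le_of_norm_le_const
  exact fun z _ => hM z

lemma frac_deriv (v : ℝ → ℝ) (hm : Measurable v) (M : ℝ) (hM : ∀ y, |v y| ≤ M)
    (T : Set ℝ) (hT : T.Countable) (hc : ∀ y, y ∉ T → ContinuousAt v y)
    (β : ℝ) (hβ : -1 < β) (c z : ℝ) :
    IntegrableOn (fun t : ℝ => t ^ β * ((∫ s in (0:ℝ)..(z + t), v s) - c)) (Set.Ioo 0 1) volume ∧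
    HasDerivAt (fun z => ∫ t in Set.Ioo (0:ℝ) 1, t ^ β * ((∫ s in (0:ℝ)..(z + t), v s) - c))
      (∫ t in Set.Ioo (0:ℝ) 1, t ^ β * v (z + t)) z := by
  have M0 : 0 ≤ M := (abs_nonneg _).trans (hM 0)
  have I := bdd_intervalIntegrable v hm M hM
  have hcont : Continuous (fun x => ∫ s in (0:ℝ)..x, v s) := intervalIntegral.continuous_primitive I 0
  have hmeas : ∀ z : ℝ, Measurable (fun t : ℝ => (∫ s in (0:ℝ)..(z + t), v s) - c) := by
    intro z
    exact ((hcont.comp (continuous_const.add continuous_id)).measurable).sub_const c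
  have hint : IntegrableOn (fun t : ℝ => t ^ β * ((∫ s in (0:ℝ)..(z + t), v s) - c))
      (Set.Ioo 0 1) volume := by
    apply rpow_mul_intOn β hβ _ (hmeas z) (M * (|z| + 1) + |c|)
    intro t ht
    have h1 := prim_lip v hm M hM (z+t) 0
    simp only [intervalIntegral.integral_same, sub_zero] at h1
    have h2 : |z + t| ≤ |z| + 1 := by
      have := abs_add_le z t
      rw [abs_of_pos ht.1] at this
      linarith [ht.2]
    calc _ ≤ _ := abs_sub _ _
      _ ≤ M * (|z| + 1) + |c| := by gcongr; exact h1.trans (by gcongr)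
  refine ⟨hint, ?_⟩
  refine (hasDerivAt_integral_of_dominated_loc_of_lip (μ := volume.restrict (Set.Ioo (0:ℝ) 1))
    (F := fun z t => t ^ β * ((∫ s in (0:ℝ)..(z + t), v s) - c)) (x₀ := z)
    (F' := fun t => t ^ β * v (z + t))
    (bound := fun t => t ^ β * M) (s := Set.univ)
    Filter.univ_mem ?_ hint ?_ ?_ ?_ ?_).2
  · apply Filter.Eventually.of_forall
    intro z
    apply Measurable.aestronglyMeasurable
    have := hmeas z
    fun_prop
  · apply Measurable.aestronglyMeasurable
    fun_prop
  · refine (ae_restrict_iff' measurableSet_Ioo).2 (Filter.Eventually.of_forall ?_)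
    intro t ht
    apply LipschitzOnWith.of_dist_le_mul
    intro x _ y _
    rw [Real.coe_nnabs, Real.dist_eq, Real.dist_eq, ← mul_sub, abs_mul, abs_mul, mul_assoc,
      abs_of_nonneg M0]
    apply mul_le_mul_of_nonneg_left _ (abs_nonneg _)
    have := prim_lip v hm M hM (x+t) (y+t)
    simpa using this
  · exact (rpow_intOn β hβ).mul_const M
  · apply ae_restrict_of_ae
    have : ∀ᵐ t : ℝ, t ∉ (fun t => z + t) ⁻¹' T := by
      rw [ae_iff]
      simp only [not_not]
      exact (hT.preimage (add_right_injective z)).measure_zero _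
    filter_upwards [this] with t ht
    apply HasDerivAt.const_mul
    apply HasDerivAt.sub_const
    have h := intervalIntegral.integral_hasDerivAt_right (I 0 (z+t))
      (hm.stronglyMeasurable.stronglyMeasurableAtFilter) (hc (z+t) ht)
    exact h.comp_add_const z t

lemma near_formula (u g w : ℝ → ℝ) (hgm : Measurable g) (hwm : Measurable w) (G W : ℝ)
    (hG : ∀ y, |g y| ≤ G) (hW : ∀ y, |w y| ≤ W) (T : Set ℝ) (hT : T.Countable)
    (hgc : ∀ y, y ∉ T → ContinuousAt g y) (hwc : ∀ y, y ∉ T → ContinuousAt w y)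
    (cu cw G1 : ℝ) (hu : ∀ y, 0 < y → u y = (∫ s in (0:ℝ)..y, g s) - cu)
    (hg : ∀ y, 0 < y → g y = (∫ s in (0:ℝ)..y, w s) - cw + if y < 1 then G1 else 0)
    (hu1 : ∀ y, 1 ≤ y → u y = 0) (β : ℝ) (hβ : -1 < β) (x : ℝ) (hx : x ∈ Set.Ioo (0:ℝ) 1) :
    deriv (deriv (fun z => ∫ y in z..(1:ℝ), (y - z) ^ β * u y)) x =
      - G1 * (1 - x) ^ β + ∫ t in Set.Ioo (0:ℝ) 1, t ^ β * w (x + t) := by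
  have e1 : ∀ z ∈ Set.Ioo (0:ℝ) 1, ∫ y in z..(1:ℝ), (y - z) ^ β * u y =
      ∫ t in Set.Ioo (0:ℝ) 1, t ^ β * ((∫ s in (0:ℝ)..(z + t), g s) - cu) := by
    intro z hz
    have := intervalIntegral.integral_comp_add_right (a := 0) (b := 1 - z)
      (fun y => (y - z) ^ β * u y) z
    simp only [zero_add, sub_add_cancel, add_sub_cancel_right] at this
    rw [← this, intervalIntegral.integral_of_le (by linarith [hz.2])]
    rw [← integral_Ioc_eq_integral_Ioo]
    rw [← setIntegral_eq_of_subset_of_forall_sdiff_eq_zero (s := Set.Ioc 0 (1-z)) (t := Set.Ioc 0 1)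
      (f := fun t => t ^ β * u (t + z))]
    · apply setIntegral_congr_fun measurableSet_Ioc
      intro t ht
      simp only
      rw [hu _ (by linarith [ht.1, hz.1]), add_comm t z]
    · exact measurableSet_Ioc
    · exact Set.Ioc_subset_Ioc_right (by linarith [hz.1])
    · intro t ht
      rw [hu1, mul_zero]
      by_contra h
      exact ht.2 ⟨ht.1.1, by linarith⟩
  have e2 : ∀ z ∈ Set.Ioo (0:ℝ) 1, deriv (fun z => ∫ y in z..(1:ℝ), (y - z) ^ β * u y) z =
      (∫ t in Set.Ioo (0:ℝ) 1, t ^ β * ((∫ s in (0:ℝ)..(z + t), w s) - cw))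
        + G1 * ((1 - z) ^ (β + 1) / (β + 1)) := by
    intro z hz
    have ev : (fun z => ∫ y in z..(1:ℝ), (y - z) ^ β * u y) =ᶠ[nhds z]
        fun z => ∫ t in Set.Ioo (0:ℝ) 1, t ^ β * ((∫ s in (0:ℝ)..(z + t), g s) - cu) := by
      filter_upwards [isOpen_Ioo.mem_nhds hz] with y hy using e1 y hy
    rw [ev.deriv_eq, (frac_deriv g hgm G hG T hT hgc β hβ cu z).2.deriv]
    have s1 : ∫ t in Set.Ioo (0:ℝ) 1, t ^ β * g (z + t) = ∫ t in Set.Ioo (0:ℝ) 1,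
       (t ^ β * ((∫ s in (0:ℝ)..(z + t), w s) - cw) + t ^ β * (if z + t < 1 then G1 else 0)) := by
      apply setIntegral_congr_fun measurableSet_Ioo
      intro t ht
      simp only
      rw [hg (z+t) (by linarith [ht.1, hz.1])]; ring
    rw [s1, integral_add]
    · congr 1
      rw [← integral_Ioc_eq_integral_Ioo]
      rw [setIntegral_eq_of_subset_of_forall_sdiff_eq_zero (s := Set.Ioo 0 (1-z)) (t := Set.Ioc 0 1)]
      · have : ∫ t in Set.Ioo 0 (1-z), t ^ β * (if z + t < 1 then G1 else 0) =
          ∫ t in Set.Ioo 0 (1-z), G1 * t ^ β := by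
          apply setIntegral_congr_fun measurableSet_Ioo
          intro t ht
          simp only
          rw [if_pos (by linarith [ht.2])]; ring
        rw [this, integral_const_mul, ← integral_Ioc_eq_integral_Ioo,
          ← intervalIntegral.integral_of_le (by linarith [hz.2]), integral_rpow (Or.inl hβ),
          Real.zero_rpow (by linarith), sub_zero]
      · exact measurableSet_Ioc
      · exact fun t ht => ⟨ht.1, by linarith [ht.2, hz.1]⟩
      · intro t ht
        rw [if_neg, mul_zero]
        intro h
        exact ht.2 ⟨ht.1.1, by linarith⟩
    · exact (frac_deriv w hwm W hW T hT hwc β hβ cw z).1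
    · apply rpow_mul_intOn β hβ _ _ (|G1|)
      · intro t _
        split_ifs <;> simp
      · refine Measurable.ite ?_ measurable_const measurable_const
        exact measurableSet_lt (by fun_prop) (by fun_prop)
  have ev : deriv (fun z => ∫ y in z..(1:ℝ), (y - z) ^ β * u y) =ᶠ[nhds x] fun z =>
      (∫ t in Set.Ioo (0:ℝ) 1, t ^ β * ((∫ s in (0:ℝ)..(z + t), w s) - cw))
        + G1 * ((1 - z) ^ (β + 1) / (β + 1)) := by
    filter_upwards [isOpen_Ioo.mem_nhds hx] with y hy using e2 y hy
  rw [ev.deriv_eq]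
  have d1 := (frac_deriv w hwm W hW T hT hwc β hβ cw x).2
  have d2 : HasDerivAt (fun z : ℝ => G1 * ((1 - z) ^ (β + 1) / (β + 1))) (- G1 * (1 - x) ^ β) x := by
    have := (((hasDerivAt_id x).const_sub 1).rpow_const (p := β + 1)
      (Or.inl (by simp only [id]; linarith [hx.2]))).div_const (β+1) |>.const_mul G1
    refine this.congr_deriv ?_
    have : β + 1 ≠ 0 := by linarith
    simp only [id, add_sub_cancel_right]
    field_simp
  refine (d1.add d2).deriv.trans ?_
  ring

lemma prim_of_deriv (f f' : ℝ → ℝ) (hm : Measurable f') (M : ℝ) (hM : ∀ y, |f' y| ≤ M)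
    (T : Set ℝ) (hT : T.Countable) (hc : ContinuousOn f (Set.Ioo 0 1))
    (hd : ∀ y, y ∉ T → HasDerivAt f (f' y) y) :
    ∃ c, ∀ y ∈ Set.Ioo (0:ℝ) 1, f y = (∫ s in (0:ℝ)..y, f' s) - c := by
  have I := bdd_intervalIntegrable f' hm M hM
  refine ⟨(∫ s in (0:ℝ)..(1/2), f' s) - f (1/2), fun y hy => ?_⟩
  have h := integral_eq_of_hasDerivAt_off_countable f f' (a := 1/2) (b := y) hT
    (hc.mono ?_) (fun x hx => hd x hx.2) (I _ _)
  · have h2 := intervalIntegral.integral_add_adjacent_intervals (I 0 (1/2)) (I (1/2) y)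
    linarith
  · intro x hx
    rcases Set.mem_uIcc.1 hx with h | h
    · exact ⟨by linarith [h.1], by linarith [h.2, hy.2]⟩
    · exact ⟨by linarith [h.1, hy.1], by linarith [h.2]⟩

lemma far_deriv (u : ℝ → ℝ) (hm : Measurable u) (M : ℝ) (hM : ∀ y, |u y| ≤ M) (a b γ : ℝ) (hγ : γ ≤ 0)
    (z : ℝ) (hz : z < a) :
    HasDerivAt (fun z => ∫ y in Set.Icc a b, (y - z) ^ γ * u y)
      (-γ * ∫ y in Set.Icc a b, (y - z) ^ (γ - 1) * u y) z := by
  have M0 : 0 ≤ M := (abs_nonneg _).trans (hM 0)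
  set δ := (a - z) / 2 with hδ
  have δ0 : 0 < δ := by rw [hδ]; linarith
  have key : ∀ x < z + δ, ∀ y ∈ Set.Icc a b, δ ≤ y - x := by
    intro x hx y hy
    have := hy.1
    linarith
  have hmz : ∀ (e z : ℝ), Measurable (fun y : ℝ => (y - z) ^ e * u y) := by
    intro e z; fun_prop
  rw [← integral_const_mul]
  refine (hasDerivAt_integral_of_dominated_loc_of_deriv_le
    (F' := fun x y => -γ * ((y - x) ^ (γ - 1) * u y))
    (bound := fun t => |γ| * (δ ^ (γ-1) * M)) (s := Set.Iio (z + δ))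
    (Iio_mem_nhds (by linarith)) ?_ ?_ ?_ ?_ ?_ ?_).2
  · exact Filter.Eventually.of_forall (fun z => (hmz γ z).aestronglyMeasurable)
  · apply Measure.integrableOn_of_bounded (M := δ ^ γ * M)
    · exact measure_Icc_lt_top.ne
    · exact (hmz γ z).aestronglyMeasurable
    · refine (ae_restrict_iff' measurableSet_Icc).2 (Filter.Eventually.of_forall ?_)
      intro y hy
      have h := key z (by linarith) y hy
      rw [norm_mul, Real.norm_eq_abs, Real.norm_eq_abs, abs_of_nonneg (Real.rpow_nonneg (by linarith) _)]
      exact mul_le_mul (Real.rpow_le_rpow_of_nonpos δ0 h hγ) (hM y) (abs_nonneg _) (by positivity)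
  · exact ((hmz (γ-1) z).const_mul (-γ)).aestronglyMeasurable
  · refine (ae_restrict_iff' measurableSet_Icc).2 (Filter.Eventually.of_forall ?_)
    intro y hy x hx
    have h := key x hx y hy
    rw [norm_mul, norm_mul, Real.norm_eq_abs, Real.norm_eq_abs, Real.norm_eq_abs, abs_neg,
      abs_of_nonneg (Real.rpow_nonneg (show 0 ≤ y - x by linarith) _)]
    apply mul_le_mul_of_nonneg_left _ (abs_nonneg _)
    exact mul_le_mul (Real.rpow_le_rpow_of_nonpos δ0 h (by linarith)) (hM y) (abs_nonneg _)
      (by positivity)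
  · exact integrable_const _
  · refine (ae_restrict_iff' measurableSet_Icc).2 (Filter.Eventually.of_forall ?_)
    intro y hy x hx
    have h := key x hx y hy
    have := (((hasDerivAt_id x).const_sub y).rpow_const (p := γ)
      (Or.inl (by simp only [id]; linarith))).mul_const (u y)
    refine this.congr_deriv ?_
    simp only [id]; ring

lemma far_bound (u : ℝ → ℝ) (hm : Measurable u) (M : ℝ) (hM : ∀ y, |u y| ≤ M) (a b β : ℝ) (hβ : β ≤ 0)
    (hab : a ≤ b) (hb : b ≤ 1) (hs : ∀ y, y < a ∨ b ≤ y → u y = 0)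
    (x : ℝ) (hx : x < a) :
    |deriv (deriv (fun z => ∫ y in z..(1:ℝ), (y - z) ^ β * u y)) x| ≤
      |β * (β - 1)| * ((a - x) ^ (β - 2) * M * (b - a)) := by
  have M0 : 0 ≤ M := (abs_nonneg _).trans (hM 0)
  have e1 : ∀ z < a, ∫ y in z..(1:ℝ), (y - z) ^ β * u y = ∫ y in Set.Icc a b, (y - z) ^ β * u y := by
    intro z hz
    rw [intervalIntegral.integral_of_le (by linarith)]
    apply setIntegral_eq_of_subset_of_forall_sdiff_eq_zero measurableSet_Ioc
    · exact fun y hy => ⟨by linarith [hy.1], by linarith [hy.2]⟩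
    · intro y hy
      rw [hs, mul_zero]
      by_contra h
      push Not at h
      exact hy.2 ⟨h.1, h.2.le⟩
  have e2 : ∀ z < a, deriv (fun z => ∫ y in z..(1:ℝ), (y - z) ^ β * u y) z =
      -β * ∫ y in Set.Icc a b, (y - z) ^ (β-1) * u y := by
    intro z hz
    have ev : (fun z => ∫ y in z..(1:ℝ), (y - z) ^ β * u y) =ᶠ[nhds z]
        fun z => ∫ y in Set.Icc a b, (y - z) ^ β * u y := by
      filter_upwards [Iio_mem_nhds hz] with y hy using e1 y hy
    rw [ev.deriv_eq, (far_deriv u hm M hM a b β hβ z hz).deriv]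
  have ev : deriv (fun z => ∫ y in z..(1:ℝ), (y - z) ^ β * u y) =ᶠ[nhds x]
        fun z => -β * ∫ y in Set.Icc a b, (y - z) ^ (β-1) * u y := by
    filter_upwards [Iio_mem_nhds hx] with y hy using e2 y hy
  rw [ev.deriv_eq, ((far_deriv u hm M hM a b (β-1) (by linarith) x hx).const_mul (-β)).deriv]
  rw [← mul_assoc, abs_mul, neg_mul_neg]
  apply mul_le_mul_of_nonneg_left _ (abs_nonneg _)
  have e3 : β - 1 - 1 = β - 2 := by ring
  rw [e3]
  have := norm_setIntegral_le_of_norm_le_const (μ := volume) (s := Set.Icc a b)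
    (f := fun y => (y - x) ^ (β - 2) * u y) (C := (a - x) ^ (β-2) * M) measure_Icc_lt_top ?_
  · simpa [hab] using this
  · intro y hy
    have := hy.1
    rw [norm_mul, Real.norm_eq_abs, Real.norm_eq_abs, abs_of_nonneg (Real.rpow_nonneg (by linarith) _)]
    exact mul_le_mul (Real.rpow_le_rpow_of_nonpos (by linarith) (by linarith) (by linarith)) (hM y)
      (abs_nonneg _) (Real.rpow_nonneg (by linarith) _)

lemma frac_int_bound (w : ℝ → ℝ) (W : ℝ) (hW : ∀ y, |w y| ≤ W) (β : ℝ) (hβ : -1 < β)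
    (x r : ℝ) (hr : 0 ≤ r) (hs : ∀ y, x + r < y → w y = 0) :
    |∫ t in Set.Ioo (0:ℝ) 1, t ^ β * w (x + t)| ≤ W * (r ^ (β + 1) / (β + 1)) := by
  have W0 : 0 ≤ W := (abs_nonneg _).trans (hW 0)
  have I : IntegrableOn (fun t : ℝ => t ^ β * W) (Set.Ioc 0 r) volume := by
    have := (intervalIntegral.intervalIntegrable_rpow' (a := 0) (b := r) hβ).mul_const W
    rwa [intervalIntegrable_iff_integrableOn_Ioc_of_le hr] at this
  have s1 : ∫ t in Set.Ioo (0:ℝ) 1, t ^ β * w (x + t) =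
      ∫ t in Set.Ioo (0:ℝ) 1 ∩ Set.Ioc 0 r, t ^ β * w (x + t) := by
    apply setIntegral_eq_of_subset_of_forall_sdiff_eq_zero measurableSet_Ioo Set.inter_subset_left
    intro t ht
    rw [hs, mul_zero]
    by_contra h
    exact ht.2 ⟨ht.1, ht.1.1, by linarith⟩
  rw [s1]
  calc _ ≤ ∫ t in Set.Ioo (0:ℝ) 1 ∩ Set.Ioc 0 r, t ^ β * W := by
        rw [← Real.norm_eq_abs]
        apply norm_integral_le_of_norm_le (I.mono_set Set.inter_subset_right)
        refine (ae_restrict_iff' (measurableSet_Ioo.inter measurableSet_Ioc)).2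
          (Filter.Eventually.of_forall ?_)
        intro t ht
        rw [norm_mul, Real.norm_eq_abs, Real.norm_eq_abs,
          abs_of_nonneg (Real.rpow_nonneg ht.1.1.le _)]
        exact mul_le_mul_of_nonneg_left (hW _) (Real.rpow_nonneg ht.1.1.le _)
    _ ≤ ∫ t in Set.Ioc 0 r, t ^ β * W := by
        apply setIntegral_mono_set I
        · refine (ae_restrict_iff' measurableSet_Ioc).2 (Filter.Eventually.of_forall ?_)
          intro t ht
          exact mul_nonneg (Real.rpow_nonneg ht.1.le _) W0
        · exact Filter.Eventually.of_forall (fun t ht => ht.2)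
    _ = _ := by
        rw [← intervalIntegral.integral_of_le hr, intervalIntegral.integral_mul_const,
          integral_rpow (Or.inl hβ), Real.zero_rpow (by linarith), sub_zero]; ring

lemma prim_const (v : ℝ → ℝ) (hm : Measurable v) (M : ℝ) (hM : ∀ y, |v y| ≤ M)
    (h1 : ∀ y, 1 ≤ y → v y = 0) (y : ℝ) (hy : 1 ≤ y) :
    ∫ s in (0:ℝ)..y, v s = ∫ s in (0:ℝ)..1, v s := by
  have I := bdd_intervalIntegrable v hm M hM
  rw [← intervalIntegral.integral_add_adjacent_intervals (I 0 1) (I 1 y)]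
  have : ∫ s in (1:ℝ)..y, v s = ∫ s in (1:ℝ)..y, (0:ℝ) := by
    apply intervalIntegral.integral_congr
    intro s hs
    rw [Set.uIcc_of_le hy] at hs
    exact h1 s hs.1
  rw [this]; simp

lemma spline_near (k n : ℕ) (hn : 1 ≤ n) (j : ℕ) (hj : j + 1 ≤ n + (k+2)) (β : ℝ) (hβ : -1 < β) :
    ∃ G1 : ℝ, |G1| ≤ ((k+2) * 2 ^ (k+2) + (k+2) * (k+1) * 2 ^ (k+2)) * n ∧
      ∀ x ∈ Set.Ioo (0:ℝ) 1,
      deriv (deriv (fun z => ∫ y in z..(1:ℝ), (y - z) ^ β * bspline (k+2) n (k+2) j y)) x =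
      - G1 * (1 - x) ^ β + ∫ t in Set.Ioo (0:ℝ) 1, t ^ β * ddspl (k+2) n k j (x + t) := by
  have hn' : (1:ℝ) ≤ n := by exact_mod_cast hn
  set p := k + 2 with hp
  set T := Set.range (knot p n)
  have hT : T.Countable := Set.countable_range _
  have hgm := dspl_meas p n p j
  have hwm := ddspl_meas p n k j
  have hG := dspl_bound p n hn p j
  have hW := ddspl_bound p n hn k j
  have hw1 : ∀ y, 1 ≤ y → ddspl p n k j y = 0 := fun y hy =>
    ddspl_supp p n hn k j y (Or.inr ((knot_le_one p n hn _).trans hy))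
  have hg1 : ∀ y, 1 ≤ y → dspl p n p j y = 0 := fun y hy =>
    dspl_supp p n hn p j y (Or.inr ((knot_le_one p n hn _).trans hy))
  have hu1 : ∀ y, 1 ≤ y → bspline p n p j y = 0 := fun y hy =>
    bs_supp p n hn p j y (Or.inr ((knot_le_one p n hn _).trans hy))
  obtain ⟨c, hc⟩ := prim_of_deriv (dspl p n p j) (ddspl p n k j) hwm _ hW T hT
    (dspl_cont p n hn k j) (fun y hy => dspl_deriv p n hn k j y hy)
  obtain ⟨c', hc'⟩ := prim_of_deriv (bspline p n p j) (dspl p n p j) hgm _ hG T hT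
    (bs_cont p n hn (k+1) j) (fun y hy => bs_deriv p n hn p j y hy)
  have hcu : c' = ∫ s in (0:ℝ)..1, dspl p n p j s := by
    have t1 := bs_tendsto p n hn p j hj
    have hcont : Continuous (fun x => ∫ s in (0:ℝ)..x, dspl p n p j s) :=
      intervalIntegral.continuous_primitive (bdd_intervalIntegrable _ hgm _ hG) 0
    have t2 : Filter.Tendsto (fun x => (∫ s in (0:ℝ)..x, dspl p n p j s) - c')
        (nhdsWithin 1 (Set.Iio 1)) (nhds ((∫ s in (0:ℝ)..1, dspl p n p j s) - c')) :=
      ((hcont.tendsto 1).mono_left nhdsWithin_le_nhds).sub_const c'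
    have t3 := t2.congr' (f₂ := bspline p n p j) (by
      have : Set.Ioo (0:ℝ) 1 ∈ nhdsWithin (1:ℝ) (Set.Iio 1) := Ioo_mem_nhdsLT zero_lt_one
      filter_upwards [this] with y hy
      exact (hc' y hy).symm)
    have := tendsto_nhds_unique t1 t3
    linarith
  refine ⟨(∫ s in (0:ℝ)..1, ddspl p n k j s) - c, ?_, fun x hx => ?_⟩
  · set y : ℝ := 1 - 1 / (2 * n) with hy
    have hpos : 0 < 1 / (2 * (n:ℝ)) := by positivity
    have hle : 1 / (2 * (n:ℝ)) ≤ 1 / 2 := by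
      apply one_div_le_one_div_of_le <;> linarith
    have h1 := hc y ⟨by linarith, by linarith⟩
    have h2 := prim_lip _ hwm _ hW 1 y
    have h3 := hG y
    have e : (1:ℝ) - y = 1 / (2 * n) := by rw [hy]; ring
    rw [e, abs_of_pos hpos] at h2
    have e2 : (∫ s in (0:ℝ)..1, ddspl p n k j s) - c = dspl p n p j y +
      ((∫ s in (0:ℝ)..1, ddspl p n k j s) - ∫ s in (0:ℝ)..y, ddspl p n k j s) := by
      rw [h1]; ring
    rw [e2]
    refine (abs_add_le _ _).trans ((add_le_add h3 h2).trans ?_)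
    have e3 : ((k:ℝ) + 2) * (k + 1) * 2 ^ (k + 2) * (n:ℝ) ^ 2 * (1 / (2 * n)) =
      ((k:ℝ) + 2) * (k + 1) * 2 ^ (k + 2) * n / 2 := by field_simp
    rw [e3, hp]
    push_cast
    have : 0 ≤ ((k:ℝ) + 2) * (k + 1) * 2 ^ (k + 2) * n := by positivity
    nlinarith
  · refine near_formula (bspline p n p j) (dspl p n p j) (ddspl p n k j) hgm hwm _ _ hG hW T hT
      (dspl_cont_off p n hn p j) (ddspl_cont_off p n hn k j) c' (∫ s in (0:ℝ)..1, ddspl p n k j s) _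
      ?_ ?_ hu1 β hβ x hx
    · intro y hy
      rcases lt_or_ge y 1 with h | h
      · exact hc' y ⟨hy, h⟩
      · rw [hu1 y h, prim_const _ hgm _ hG hg1 y h, hcu, sub_self]
    · intro y hy
      rcases lt_or_ge y 1 with h | h
      · rw [if_pos h, hc y ⟨hy, h⟩]; ring
      · rw [if_neg (not_lt.2 h), hg1 y h, prim_const _ hwm _ hW hw1 y h]; ring

lemma zero_region (u : ℝ → ℝ) (b β x : ℝ) (hs : ∀ y, b ≤ y → u y = 0) (hx : b < x) (hx1 : x < 1) :
    deriv (deriv (fun z => ∫ y in z..(1:ℝ), (y - z) ^ β * u y)) x = 0 := by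
  have ev : (fun z => ∫ y in z..(1:ℝ), (y - z) ^ β * u y) =ᶠ[nhds x] fun _ => (0:ℝ) := by
    filter_upwards [Ioo_mem_nhds hx hx1] with z hz
    have : ∫ y in z..(1:ℝ), (y - z) ^ β * u y = ∫ y in z..(1:ℝ), (0:ℝ) := by
      apply intervalIntegral.integral_congr
      intro s hs'
      rw [Set.uIcc_of_le hz.2.le] at hs'
      simp only
      rw [hs s (hz.1.le.trans hs'.1), mul_zero]
    rw [this]; simp
  rw [ev.deriv.deriv_eq]
  simp

lemma greville_bounds (p n : ℕ) (hp : 2 ≤ p) (hn : 1 ≤ n) (i : ℕ) :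
    knot p n (i+1) ≤ greville p n i ∧ greville p n i ≤ knot p n (i + p) := by
  have hp' : (0:ℝ) < p := by exact_mod_cast (by omega : 0 < p)
  unfold greville
  rw [le_div_iff₀ hp', div_le_iff₀ hp']
  constructor
  · calc _ = ∑ j ∈ Finset.range p, knot p n (i+1) := by simp; ring
      _ ≤ _ := Finset.sum_le_sum (fun j _ => knot_mono p n hn (by omega))
  · calc _ ≤ ∑ j ∈ Finset.range p, knot p n (i+p) :=
          Finset.sum_le_sum (fun j hj => knot_mono p n hn (by have := Finset.mem_range.1 hj; omega))
      _ = _ := by simp; ring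

lemma greville_pos (p n : ℕ) (hp : 2 ≤ p) (hn : 1 ≤ n) (i : ℕ) (hi : 2 ≤ i) :
    0 < greville p n i := by
  have hn' : (0:ℝ) < n := by exact_mod_cast hn
  have hp' : (0:ℝ) < p := by exact_mod_cast (by omega : 0 < p)
  unfold greville
  apply div_pos _ hp'
  apply Finset.sum_pos' (fun j _ => knot_nonneg p n hn _)
  refine ⟨p - 1, Finset.mem_range.2 (by omega), ?_⟩
  rw [knot_form p n hn]
  apply div_pos _ hn'
  exact_mod_cast (by omega : 0 < min n (i + 1 + (p - 1) - (p + 1)))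

lemma greville_le (p n : ℕ) (hp : 2 ≤ p) (hn : 1 ≤ n) (i : ℕ) (hi : i + 1 ≤ n + p) :
    1 / ((p:ℝ) * n) ≤ 1 - greville p n i := by
  have hn' : (0:ℝ) < n := by exact_mod_cast hn
  have hp' : (0:ℝ) < p := by exact_mod_cast (by omega : 0 < p)
  unfold greville
  have h0 : knot p n (i+1) ≤ 1 - 1 / n := by
    rw [knot_form p n hn, div_le_iff₀ hn', sub_mul, div_mul_cancel₀ _ hn'.ne']
    have : min n (i + 1 - (p + 1)) + 1 ≤ n := by omega
    have h : ((min n (i + 1 - (p + 1)) : ℕ) : ℝ) + 1 ≤ n := by exact_mod_cast this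
    linarith
  have h : ∑ j ∈ Finset.range p, knot p n (i + 1 + j) ≤ p - 1 / n := by
    obtain ⟨q, rfl⟩ : ∃ q, p = q + 1 := ⟨p - 1, by omega⟩
    rw [Finset.sum_range_succ']
    have : ∑ j ∈ Finset.range q, knot (q+1) n (i + 1 + (j+1)) ≤ ∑ j ∈ Finset.range q, (1:ℝ) :=
      Finset.sum_le_sum (fun j _ => knot_le_one _ n hn _)
    simp only [Finset.sum_const, Finset.card_range, nsmul_eq_mul, mul_one, add_zero] at this ⊢
    push_cast
    linarith
  have : (∑ j ∈ Finset.range p, knot p n (i + 1 + j)) / p ≤ (p - 1/n) / p := by gcongr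
  have e : ((p:ℝ) - 1/n) / p = 1 - 1 / (p * n) := by field_simp
  linarith

lemma knot_index (p n : ℕ) (hn : 1 ≤ n) (i : ℕ) (h1 : 1 ≤ i) (h2 : i ≤ n + 2 * p + 1) :
    (i:ℝ) - (2 * p + 1) ≤ n * knot p n i ∧ n * knot p n i ≤ i - 1 := by
  have hn' : (0:ℝ) < n := by exact_mod_cast hn
  rw [knot_form p n hn, mul_div_cancel₀ _ hn'.ne']
  constructor
  · have : i ≤ min n (i - (p+1)) + (2 * p + 1) := by omega
    have h : (i:ℝ) ≤ ((min n (i - (p+1)) : ℕ) : ℝ) + (2 * p + 1) := by exact_mod_cast this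
    linarith
  · have : min n (i - (p+1)) + 1 ≤ i := by omega
    have h : ((min n (i - (p+1)) : ℕ) : ℝ) + 1 ≤ i := by exact_mod_cast this
    linarith

lemma index_close (p n : ℕ) (hp : 2 ≤ p) (hn : 1 ≤ n) (i j : ℕ) (hi : 2 ≤ i) (hi' : i + 1 ≤ n + p)
    (hj : 2 ≤ j) (hj' : j + 1 ≤ n + p) :
    |((i:ℝ) - j) + n * (knot p n j - greville p n i)| ≤ 3 * p := by
  have hn' : (0:ℝ) < n := by exact_mod_cast hn
  have hp' : (2:ℝ) ≤ p := by exact_mod_cast hp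
  obtain ⟨g1, g2⟩ := greville_bounds p n hp hn i
  have a1 := (knot_index p n hn (i+1) (by omega) (by omega)).1
  have a2 := (knot_index p n hn (i+p) (by omega) (by omega)).2
  obtain ⟨b1, b2⟩ := knot_index p n hn j (by omega) (by omega)
  have g1' := mul_le_mul_of_nonneg_left g1 hn'.le
  have g2' := mul_le_mul_of_nonneg_left g2 hn'.le
  push_cast at a1 a2
  rw [mul_sub, abs_le]
  constructor <;> linarith

lemma near_est (k : ℕ) (α : ℝ) (h1 : 1 < α) (h2 : α < 2) :
    ∃ C ≥ (0:ℝ), ∀ n : ℕ, 1 ≤ n → ∀ j : ℕ, j + 1 ≤ n + (k+2) → ∀ x : ℝ, 0 < x →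
      1 / (((k+2:ℕ):ℝ) * n) ≤ 1 - x → knot (k+2) n j ≤ x + 1 / n →
      (n:ℝ) ^ (-α) * |deriv (deriv (fun z => ∫ y in z..(1:ℝ),
        (y - z) ^ (1-α) * bspline (k+2) n (k+2) j y)) x| ≤ C := by
  set CG : ℝ := ((k+2) * 2 ^ (k+2) + (k+2) * (k+1) * 2 ^ (k+2)) with hCG
  set CW : ℝ := (k+2) * (k+1) * 2 ^ (k+2) with hCW
  have CG0 : 0 ≤ CG := by positivity
  have CW0 : 0 ≤ CW := by positivity
  refine ⟨CG * ((k+2:ℕ):ℝ) ^ (α-1) + CW * (((k:ℝ)+4) ^ (2-α) / (2-α)), ?_, ?_⟩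
  · have : 0 < 2 - α := by linarith
    positivity
  intro n hn j hj x hx0 hx1 hxa
  have hn' : (0:ℝ) < n := by exact_mod_cast hn
  have hpn : 0 < 1 / (((k+2:ℕ):ℝ) * n) := by positivity
  obtain ⟨G1, hG1, hF⟩ := spline_near k n hn j hj (1-α) (by linarith)
  rw [hF x ⟨hx0, by linarith⟩]
  have B1 : |-G1 * (1 - x) ^ (1 - α)| ≤ CG * n * (((k+2:ℕ):ℝ) ^ (α-1) * (n:ℝ) ^ (α - 1)) := by
    rw [abs_mul, abs_neg, abs_of_nonneg (Real.rpow_nonneg (by linarith) _)]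
    apply mul_le_mul hG1 _ (Real.rpow_nonneg (by linarith) _) (by positivity)
    calc (1-x) ^ (1-α) ≤ (1 / (((k+2:ℕ):ℝ) * n)) ^ (1-α) :=
          Real.rpow_le_rpow_of_nonpos hpn hx1 (by linarith)
      _ = _ := by
        rw [one_div, Real.inv_rpow (by positivity), ← Real.rpow_neg (by positivity),
          Real.mul_rpow (by positivity) hn'.le, neg_sub]
  have B2 := frac_int_bound (ddspl (k+2) n k j) _ (ddspl_bound (k+2) n hn k j) (1-α) (by linarith)
    x (((k:ℝ)+4)/n) (by positivity) (by
      intro y hy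
      apply ddspl_supp _ n hn
      right
      have hw := knot_width (k+2) n hn j (k+3)
      have e : ((k+3:ℕ):ℝ)/n + 1 / n = ((k:ℝ)+4)/n := by push_cast; rw [← add_div]; ring
      rw [← add_assoc] at hw
      linarith)
  rw [show 1 - α + 1 = 2 - α by ring, Real.div_rpow (by positivity) hn'.le] at B2
  have B := (abs_add_le _ _).trans (add_le_add B1 B2)
  refine (mul_le_mul_of_nonneg_left B (by positivity)).trans (le_of_eq ?_)
  have r1 : (n:ℝ) ^ (-α) * (n * (n:ℝ) ^ (α-1)) = 1 := by
    nth_rewrite 2 [← Real.rpow_one (n:ℝ)]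
    rw [← Real.rpow_add hn', ← Real.rpow_add hn']
    ring_nf
    simp
  have r2 : (n:ℝ) ^ (-α) * ((n:ℝ)^2 * ((n:ℝ) ^ (2-α))⁻¹) = 1 := by
    rw [← Real.rpow_two, ← Real.rpow_neg hn'.le, ← Real.rpow_add hn', ← Real.rpow_add hn']
    ring_nf
    simp
  rw [mul_add]
  congr 1
  · calc _ = CG * ((k+2:ℕ):ℝ) ^ (α-1) * ((n:ℝ) ^ (-α) * (n * (n:ℝ) ^ (α-1))) := by ring
      _ = _ := by rw [r1, mul_one]
  · calc _ = CW * (((k:ℝ)+4) ^ (2-α) / (2-α)) * ((n:ℝ) ^ (-α) * ((n:ℝ)^2 * ((n:ℝ) ^ (2-α))⁻¹)) := by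
          rw [hCW]; ring
      _ = _ := by rw [r2, mul_one]

lemma far_est (p : ℕ) (α : ℝ) (h1 : 1 < α) :
    ∃ C ≥ (0:ℝ), ∀ n : ℕ, 1 ≤ n → ∀ j : ℕ, ∀ x s : ℝ, 
      s = n * (knot p n j - x) → 1 ≤ s →
      (n:ℝ) ^ (-α) * |deriv (deriv (fun z => ∫ y in z..(1:ℝ),
        (y - z) ^ (1-α) * bspline p n p j y)) x| ≤ C / s ^ 2 := by
  refine ⟨|(1-α) * (1-α-1)| * (2 ^ p * (p+1)), by positivity, ?_⟩
  intro n hn j x s hs hs1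
  have hn' : (0:ℝ) < n := by exact_mod_cast hn
  have hs0 : 0 < s := by linarith
  have hax : knot p n j - x = s / n := by rw [hs]; field_simp
  have hpos : 0 < knot p n j - x := by rw [hax]; positivity
  have hw := knot_width p n hn j (p+1)
  have F := far_bound (bspline p n p j) (bs_meas p n p j) _ (bs_bound p n hn p j) (knot p n j)
    (knot p n (j+p+1)) (1-α) (by linarith) (knot_mono p n hn (by omega)) (knot_le_one p n hn _)
    (bs_supp p n hn p j) x (by linarith)
  have hw' : knot p n (j+p+1) - knot p n j ≤ ((p:ℝ)+1)/n := by
    push_cast at hw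
    rw [← add_assoc] at hw
    linarith
  have F2 := F.trans (mul_le_mul_of_nonneg_left (mul_le_mul_of_nonneg_left hw' (by
    have := Real.rpow_nonneg hpos.le (1 - α - 2); positivity)) (abs_nonneg _))
  refine (mul_le_mul_of_nonneg_left F2 (by positivity)).trans ?_
  rw [hax, Real.div_rpow hs0.le hn'.le]
  have r1 : (n:ℝ) ^ (-α) * (((n:ℝ) ^ (1-α-2))⁻¹ * (n:ℝ)⁻¹) = 1 := by
    rw [← Real.rpow_neg hn'.le, ← Real.rpow_neg_one (n:ℝ), ← Real.rpow_add hn', ← Real.rpow_add hn']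
    ring_nf
    simp
  have r2 : s ^ (1-α-2) ≤ (s^2)⁻¹ := by
    rw [← Real.rpow_two, ← Real.rpow_neg hs0.le]
    exact Real.rpow_le_rpow_of_exponent_le hs1 (by linarith)
  calc _ = |(1-α) * (1-α-1)| * (2 ^ p * (p+1)) * s ^ (1-α-2) *
        ((n:ℝ) ^ (-α) * (((n:ℝ) ^ (1-α-2))⁻¹ * (n:ℝ)⁻¹)) := by ring
    _ = |(1-α) * (1-α-1)| * (2 ^ p * (p+1)) * s ^ (1-α-2) := by rw [r1, mul_one]
    _ ≤ |(1-α) * (1-α-1)| * (2 ^ p * (p+1)) * (s^2)⁻¹ := by gcongr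
    _ = _ := by rw [div_eq_mul_inv]

lemma entry_est (p : ℕ) (hp : 2 ≤ p) (α : ℝ) (h1 : 1 < α) (h2 : α < 2) :
    ∃ C ≥ (0:ℝ), ∀ n : ℕ, 1 ≤ n → ∀ i j : ℕ, 2 ≤ i → i + 1 ≤ n + p → 2 ≤ j → j + 1 ≤ n + p →
      |(n:ℝ) ^ (-α) * RLDx1 α (bspline p n p j) (greville p n i)| ≤ C / (1 + ((i:ℝ) - j)^2) := by
  obtain ⟨k, rfl⟩ : ∃ k, p = k + 2 := ⟨p - 2, by omega⟩
  obtain ⟨C1, C10, hC1⟩ := near_est k α h1 h2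
  obtain ⟨C2, C20, hC2⟩ := far_est (k+2) α h1
  have hΓ : 0 < Real.Gamma (2 - α) := Real.Gamma_pos_of_pos (by linarith)
  set p := k + 2 with hpk
  set K : ℝ := 1 + (4 * p + 1)^2 with hK
  have K0 : 0 ≤ K := by positivity
  refine ⟨1 / Real.Gamma (2 - α) * ((C1 + C2) * K), by positivity, ?_⟩
  intro n hn i j hi hi' hj hj'
  have hn' : (0:ℝ) < n := by exact_mod_cast hn
  have hp' : (2:ℝ) ≤ p := by exact_mod_cast hp
  have hx0 := greville_pos p n hp hn i hi
  have hx1 := greville_le p n hp hn i hi'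
  have hic := index_close p n hp hn i j hi hi' hj hj'
  set x := greville p n i with hx
  have hxlt : x < 1 := by
    have : 0 < 1 / ((p:ℝ) * n) := by positivity
    linarith
  unfold RLDx1
  rw [abs_mul, abs_mul, abs_of_pos (show 0 < 1 / Real.Gamma (2 - α) by positivity),
    abs_of_nonneg (show 0 ≤ (n:ℝ) ^ (-α) by positivity), mul_div_assoc, mul_left_comm]
  apply mul_le_mul_of_nonneg_left _ (by positivity)
  set D : ℝ := (i:ℝ) - j with hD
  have D0 : 0 < 1 + D^2 := by positivity
  rw [le_div_iff₀ D0]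
  set s := n * (knot p n j - x) with hs
  rw [abs_le] at hic
  rcases lt_or_ge (knot p n (j+p+1)) x with hz | hz
  · rw [zero_region _ (knot p n (j+p+1)) _ x (fun y hy => bs_supp p n hn p j y (Or.inr hy)) hz hxlt]
    simp; positivity
  have hw := knot_width p n hn j (p+1)
  have hs2 : -((p:ℝ)+1) ≤ s := by
    have : -(((p:ℝ)+1)/n) ≤ knot p n j - x := by
      push_cast at hw
      rw [← add_assoc] at hw
      linarith
    have := mul_le_mul_of_nonneg_left this hn'.le
    rwa [mul_neg, mul_div_cancel₀ _ hn'.ne'] at this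
  rcases le_or_gt s 1 with hs1 | hs1
  · have hxa : knot p n j ≤ x + 1 / n := by
      have : knot p n j - x ≤ 1 / n := by
        rw [le_div_iff₀ hn']; linarith
      linarith
    have E := hC1 n hn j hj' x hx0 hx1 hxa
    have hDK : 1 + D^2 ≤ K := by
      rw [hK]
      have : |D| ≤ 4 * p + 1 := by rw [abs_le]; constructor <;> linarith
      have := sq_le_sq' (abs_le.1 this).1 (abs_le.1 this).2
      linarith
    exact mul_le_mul (by linarith) hDK D0.le (by linarith)
  · have E := hC2 n hn j x s hs hs1.le
    have hs0 : 0 < s := by linarith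
    have hDK : 1 + D^2 ≤ K * s^2 := by
      have : |D| ≤ (4 * p + 1) * s := by
        rw [abs_le]; constructor <;> nlinarith
      have h3 := sq_le_sq' (abs_le.1 this).1 (abs_le.1 this).2
      have h4 : 1 ≤ s^2 := by nlinarith
      rw [hK]
      nlinarith
    calc _ ≤ C2 / s^2 * (K * s^2) := mul_le_mul E hDK D0.le (by positivity)
      _ = C2 * K := by field_simp
      _ ≤ _ := by nlinarith

lemma summable_aux : Summable (fun k : ℤ => 1 / (1 + (k:ℝ)^2)) := by
  apply Summable.of_norm_bounded_eventually (g := fun k : ℤ => 1 / (k:ℝ)^2)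
    (Real.summable_one_div_int_pow.2 one_lt_two)
  have : ∀ᶠ k : ℤ in Filter.cofinite, k ≠ 0 := by
    exact Filter.eventually_cofinite_ne 0
  filter_upwards [this] with k hk
  have hk' : (k:ℝ) ≠ 0 := by exact_mod_cast hk
  have : 0 < (k:ℝ)^2 := by positivity
  rw [Real.norm_eq_abs, abs_of_nonneg (by positivity)]
  apply one_div_le_one_div_of_le this
  linarith

lemma sum_aux (N : ℕ) (j : ℤ) :
    ∑ i : Fin N, 1 / (1 + (((i:ℕ):ℝ) - j)^2) ≤ ∑' k : ℤ, 1 / (1 + (k:ℝ)^2) := by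
  have hinj : Function.Injective (fun i : Fin N => ((i:ℕ):ℤ) - j) := by
    intro a b h
    simp only [sub_left_inj, Nat.cast_inj] at h
    exact Fin.ext h
  have := Summable.sum_le_tsum (f := fun k : ℤ => 1 / (1 + (k:ℝ)^2))
    (Finset.univ.map ⟨_, hinj⟩) (fun k _ => by positivity) summable_aux
  rw [Finset.sum_map] at this
  simpa using this

lemma schur {N : ℕ} (A : Matrix (Fin N) (Fin N) ℝ) (C : ℝ) (hC : 0 ≤ C)
    (hr : ∀ i, ∑ j, |A i j| ≤ C) (hc : ∀ j, ∑ i, |A i j| ≤ C) : matNorm2 A ≤ C := by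
  unfold matNorm2
  apply ContinuousLinearMap.opNorm_le_bound _ hC
  intro x
  apply le_of_sq_le_sq _ (by positivity)
  rw [mul_pow, EuclideanSpace.norm_sq_eq, EuclideanSpace.norm_sq_eq]
  have key : ∀ i, ‖(LinearMap.toContinuousLinearMap (Matrix.toEuclideanLin A) x) i‖^2 ≤
      C * ∑ j, |A i j| * ‖x j‖^2 := by
    intro i
    have e : (LinearMap.toContinuousLinearMap (Matrix.toEuclideanLin A) x) i = ∑ j, A i j * x j := by
      simp [Matrix.toEuclideanLin, Matrix.mulVec, dotProduct]
    rw [e]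
    have h1 : ‖∑ j, A i j * x j‖ ≤ ∑ j, |A i j| * ‖x j‖ := by
      refine (norm_sum_le _ _).trans (le_of_eq ?_)
      simp [abs_mul]
    have h2 : (∑ j, |A i j| * ‖x j‖)^2 ≤ (∑ j, |A i j|) * ∑ j, |A i j| * ‖x j‖^2 := by
      apply Finset.sum_sq_le_sum_mul_sum_of_sq_eq_mul
      · intro j _; positivity
      · intro j _; positivity
      · intro j _; ring
    calc _ ≤ (∑ j, |A i j| * ‖x j‖)^2 := by gcongr
      _ ≤ _ := h2
      _ ≤ _ := by
        apply mul_le_mul_of_nonneg_right (hr i)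
        exact Finset.sum_nonneg (fun j _ => by positivity)
  calc _ ≤ ∑ i, C * ∑ j, |A i j| * ‖x j‖^2 := Finset.sum_le_sum (fun i _ => key i)
    _ = C * ∑ j, (∑ i, |A i j|) * ‖x j‖^2 := by
      rw [← Finset.mul_sum, Finset.sum_comm]
      simp only [Finset.sum_mul]
    _ ≤ C * ∑ j, C * ‖x j‖^2 := by
      gcongr with j
      exact hc j
    _ = _ := by rw [← Finset.mul_sum]; ring

theorem stmt15 (p : ℕ) (hp : 2 ≤ p) (α : ℝ) (h1 : 1 < α) (h2 : α < 2) :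
    ∃ C > (0 : ℝ), ∀ n : ℕ, 1 ≤ n →
      matNorm1 (((n : ℝ) ^ (-α)) • ARmat p n α) ≤ C ∧
      matNorm2 (((n : ℝ) ^ (-α)) • ARmat p n α) ≤ C ∧
      matNormInf (((n : ℝ) ^ (-α)) • ARmat p n α) ≤ C := by
  obtain ⟨C, C0, hC⟩ := entry_est p hp α h1 h2
  set S : ℝ := ∑' k : ℤ, 1 / (1 + (k:ℝ)^2)
  have S0 : 0 ≤ S := tsum_nonneg (fun k => by positivity)
  refine ⟨C * S + 1, by positivity, ?_⟩
  intro n hn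
  have ent : ∀ i j, |(((n : ℝ) ^ (-α)) • ARmat p n α) i j| ≤
      C * (1 / (1 + (((i:ℕ):ℝ) - ((j:ℕ):ℤ))^2)) := by
    intro i j
    have hi := i.2
    have hj := j.2
    have := hC n hn (i+2) (j+2) (by omega) (by omega) (by omega) (by omega)
    rw [mul_one_div]
    simpa [ARmat] using this
  have hc : ∀ j, ∑ i, |(((n : ℝ) ^ (-α)) • ARmat p n α) i j| ≤ C * S + 1 := by
    intro j
    calc _ ≤ ∑ i : Fin (n + p - 2), C * (1 / (1 + (((i:ℕ):ℝ) - ((j:ℕ):ℤ))^2)) :=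
          Finset.sum_le_sum (fun i _ => ent i j)
      _ ≤ C * S := by
          rw [← Finset.mul_sum]
          exact mul_le_mul_of_nonneg_left (sum_aux _ _) C0
      _ ≤ _ := by linarith
  have hr : ∀ i, ∑ j, |(((n : ℝ) ^ (-α)) • ARmat p n α) i j| ≤ C * S + 1 := by
    intro i
    calc _ ≤ ∑ j : Fin (n + p - 2), C * (1 / (1 + (((j:ℕ):ℝ) - ((i:ℕ):ℤ))^2)) := by
          refine Finset.sum_le_sum (fun j _ => (ent i j).trans (le_of_eq ?_))
          push_cast
          ring
      _ ≤ C * S := by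
          rw [← Finset.mul_sum]
          exact mul_le_mul_of_nonneg_left (sum_aux _ _) C0
      _ ≤ _ := by linarith
  have pos : 0 ≤ C * S + 1 := by positivity
  refine ⟨?_, schur _ _ pos hr hc, ?_⟩
  · exact Real.iSup_le hc pos
  · exact Real.iSup_le hr pos
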